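/- Let s ∈ (0,1) and let n be an integer with n > 2s, and let U_i = U[z_i,λ_i], U_j = U[z_j,λ_j] be Talenti bubbles. Then there exist constants γ^a = γ^a(n,s) > 0 (a = 1,…,n+1) such that ∫_{ℝⁿ} U_i^{p−1} Z_i^a Z_i^b = 0 if a ≠ b and ∫_{ℝⁿ} U_i^{p−1} Z_i^a Z_i^a = γ^a for 1 ≤ a ≤ n+1. Moreover, if i ≠ j and 1 ≤ a, b ≤ n+1, then |∫_{ℝⁿ} U_i^{p−1} Z_i^a Z_j^b| ≤ C(n,s) q_{ij}, where q_{ij} = (λ_i/λ_j + λ_j/λ_i + λ_iλ_j|z_i−z_j|²)^{−(n−2s)/2}. -/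

import Mathlib

open MeasureTheory

noncomputable section

abbrev Euc (n : ℕ) := EuclideanSpace ℝ (Fin n)

/-- Normalization constant of the fractional Laplacian `(-Δ)^s` on `ℝⁿ`. -/
noncomputable def fracC (n : ℕ) (s : ℝ) : ℝ :=
  2 ^ (2 * s) * Real.Gamma (((n : ℝ) + 2 * s) / 2) /
    (Real.pi ^ ((n : ℝ) / 2) * |Real.Gamma (-s)|)

/-- The fractional Laplacian `(-Δ)^s u` of order `s`, as a symmetrized singular integral. -/
noncomputable def fracLap (n : ℕ) (s : ℝ) (u : Euc n → ℝ) (x : Euc n) : ℝ :=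
  (fracC n s / 2) *
    ∫ y : Euc n, (2 * u x - u (x + y) - u (x - y)) / ‖y‖ ^ ((n : ℝ) + 2 * s)

/-- The homogeneous `Ḣˢ` inner product (Gagliardo form). -/
noncomputable def hsInner (n : ℕ) (s : ℝ) (u v : Euc n → ℝ) : ℝ :=
  (fracC n s / 2) *
    ∫ x : Euc n, ∫ y : Euc n,
      (u x - u y) * (v x - v y) / ‖x - y‖ ^ ((n : ℝ) + 2 * s)

noncomputable def hsNormSq (n : ℕ) (s : ℝ) (u : Euc n → ℝ) : ℝ := hsInner n s u u

noncomputable def hsNorm (n : ℕ) (s : ℝ) (u : Euc n → ℝ) : ℝ := Real.sqrt (hsNormSq n s u)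

/-- Membership in the homogeneous Sobolev space `Ḣˢ(ℝⁿ)`. -/
def MemHs (n : ℕ) (s : ℝ) (u : Euc n → ℝ) : Prop :=
  Measurable u ∧
    Integrable (fun q : Euc n × Euc n =>
      (u q.1 - u q.2) ^ 2 / ‖q.1 - q.2‖ ^ ((n : ℝ) + 2 * s))

/-- The `H^{-s}` (dual) norm of `f`. -/
noncomputable def negSobNorm (n : ℕ) (s : ℝ) (f : Euc n → ℝ) : ℝ :=
  sSup {r : ℝ | ∃ φ : Euc n → ℝ, MemHs n s φ ∧ hsNorm n s φ ≤ 1 ∧ r = ∫ x, f x * φ x}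

/-- The critical exponent `p = 2^* - 1 = (n+2s)/(n-2s)`. -/
noncomputable def pexp (n : ℕ) (s : ℝ) : ℝ := ((n : ℝ) + 2 * s) / ((n : ℝ) - 2 * s)

/-- A Talenti bubble `U[z,λ]`. -/
noncomputable def bubble (n : ℕ) (cns : ℝ) (s : ℝ) (z : Euc n) (lam : ℝ) (x : Euc n) : ℝ :=
  cns * (lam / (1 + lam ^ 2 * ‖x - z‖ ^ 2)) ^ (((n : ℝ) - 2 * s) / 2)

/-- `∂U[z,λ]/∂λ`. -/
noncomputable def dLamBubble (n : ℕ) (cns s : ℝ) (z : Euc n) (lam : ℝ) : Euc n → ℝ :=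
  fun x => deriv (fun l : ℝ => bubble n cns s z l x) lam

/-- `∂U[z,λ]/∂z_j`. -/
noncomputable def dZBubble (n : ℕ) (cns s : ℝ) (z : Euc n) (lam : ℝ) (j : Fin n) : Euc n → ℝ :=
  fun x => deriv (fun t : ℝ => bubble n cns s (z + t • EuclideanSpace.single j (1 : ℝ)) lam x) 0

/-- The rescaled derivatives `Z_i^a` (`a = 1,…,n` translations, `a = n+1` dilation). -/
noncomputable def Zb (n : ℕ) (cns s : ℝ) (z : Euc n) (lam : ℝ) (a : Fin (n + 1)) : Euc n → ℝ :=
  if h : (a : ℕ) < n then fun x => lam⁻¹ * dZBubble n cns s z lam ⟨a, h⟩ x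
  else fun x => lam * dLamBubble n cns s z lam x

/-- A `δ`-interacting family of bubbles. -/
def DeltaInteracting (n : ℕ) {ν : ℕ} (z : Fin ν → Euc n) (lam : Fin ν → ℝ) (δ : ℝ) : Prop :=
  (∀ i, 0 < lam i) ∧
    ∀ i j, i ≠ j →
      min (lam i / lam j)
        (min (lam j / lam i) (1 / (lam i * lam j * ‖z i - z j‖ ^ 2))) ≤ δ

/-- The pairwise interaction `q_{ij}`. -/
noncomputable def qij (n : ℕ) (s : ℝ) {ν : ℕ} (z : Fin ν → Euc n) (lam : Fin ν → ℝ)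
    (i j : Fin ν) : ℝ :=
  (lam i / lam j + lam j / lam i + lam i * lam j * ‖z i - z j‖ ^ 2) ^
    (-(((n : ℝ) - 2 * s) / 2))

/-- `Q = max_{i ≠ j} q_{ij}`. -/
noncomputable def Qmax (n : ℕ) (s : ℝ) {ν : ℕ} (z : Fin ν → Euc n) (lam : Fin ν → ℝ) : ℝ :=
  sSup {q : ℝ | ∃ i j, i ≠ j ∧ q = qij n s z lam i j}

noncomputable def Rij (n : ℕ) {ν : ℕ} (z : Fin ν → Euc n) (lam : Fin ν → ℝ) (i j : Fin ν) : ℝ :=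
  max (Real.sqrt (lam i / lam j))
    (max (Real.sqrt (lam j / lam i)) (Real.sqrt (lam i * lam j) * ‖z i - z j‖))

/-- `R = (1/2) min_{i≠j} R_{ij}`. -/
noncomputable def Rmin (n : ℕ) {ν : ℕ} (z : Fin ν → Euc n) (lam : Fin ν → ℝ) : ℝ :=
  (1 / 2) * sInf {r : ℝ | ∃ i j, i ≠ j ∧ r = Rij n z lam i j}

/-- Japanese bracket `⟨y⟩ = (1+|y|²)^{1/2}`. -/
noncomputable def jbr {n : ℕ} (y : Euc n) : ℝ := Real.sqrt (1 + ‖y‖ ^ 2)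

/-- The weight function `V`. -/
noncomputable def Vwt (n : ℕ) (s : ℝ) {ν : ℕ} (z : Fin ν → Euc n) (lam : Fin ν → ℝ)
    (x : Euc n) : ℝ :=
  ∑ i, (lam i ^ (((n : ℝ) + 2 * s) / 2) * Rmin n z lam ^ (2 * s - (n : ℝ)) *
          jbr (lam i • (x - z i)) ^ (-(4 * s)) *
          (if ‖lam i • (x - z i)‖ ≤ Rmin n z lam then (1 : ℝ) else 0) +
        lam i ^ (((n : ℝ) + 2 * s) / 2) * Rmin n z lam ^ (-(4 * s)) *
          jbr (lam i • (x - z i)) ^ (2 * s - (n : ℝ)) *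
          (if Rmin n z lam / 2 ≤ ‖lam i • (x - z i)‖ then (1 : ℝ) else 0))

/-- The weight function `W`. -/
noncomputable def Wwt (n : ℕ) (s : ℝ) {ν : ℕ} (z : Fin ν → Euc n) (lam : Fin ν → ℝ)
    (x : Euc n) : ℝ :=
  ∑ i, (lam i ^ (((n : ℝ) - 2 * s) / 2) * Rmin n z lam ^ (2 * s - (n : ℝ)) *
          jbr (lam i • (x - z i)) ^ (-(2 * s)) *
          (if ‖lam i • (x - z i)‖ ≤ Rmin n z lam then (1 : ℝ) else 0) +
        lam i ^ (((n : ℝ) - 2 * s) / 2) * Rmin n z lam ^ (-(4 * s)) *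
          jbr (lam i • (x - z i)) ^ (4 * s - (n : ℝ)) *
          (if Rmin n z lam / 2 ≤ ‖lam i • (x - z i)‖ then (1 : ℝ) else 0))

/-- `‖φ‖_* = sup_x |φ(x)| W(x)⁻¹`. -/
noncomputable def starNorm (n : ℕ) (s : ℝ) {ν : ℕ} (z : Fin ν → Euc n) (lam : Fin ν → ℝ)
    (φ : Euc n → ℝ) : ℝ :=
  ⨆ x : Euc n, |φ x| / Wwt n s z lam x

/-- `‖h‖_{**} = sup_x |h(x)| V(x)⁻¹`. -/
noncomputable def dstarNorm (n : ℕ) (s : ℝ) {ν : ℕ} (z : Fin ν → Euc n) (lam : Fin ν → ℝ)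
    (h : Euc n → ℝ) : ℝ :=
  ⨆ x : Euc n, |h x| / Vwt n s z lam x

noncomputable def l2norm (n : ℕ) (f : Euc n → ℝ) : ℝ := Real.sqrt (∫ x, f x ^ 2)

/-- The error function `(-Δ)^s u - u|u|^{p-1}`. -/
noncomputable def errFun (n : ℕ) (s : ℝ) (u : Euc n → ℝ) : Euc n → ℝ :=
  fun x => fracLap n s u x - u x * |u x| ^ (pexp n s - 1)

/-- The bounded factor `φ_a` for which `Z^a(x) = ((n - 2s)/2) U(x) φ_a(λ(x - z))`. -/
def bubbleAngle (n : ℕ) (a : Fin (n + 1)) (y : Euc n) : ℝ :=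
  if h : (a : ℕ) < n then 2 * y ⟨a, h⟩ / (1 + ‖y‖ ^ 2) else (1 - ‖y‖ ^ 2) / (1 + ‖y‖ ^ 2)

lemma continuous_bubbleAngle (n : ℕ) (a : Fin (n + 1)) : Continuous (bubbleAngle n a) := by
  have h0 (y : Euc n) : 1 + ‖y‖ ^ 2 ≠ 0 := by positivity
  by_cases h : (a : ℕ) < n
  · rw [show bubbleAngle n a = fun y => 2 * y ⟨a, h⟩ / (1 + ‖y‖ ^ 2) from
      funext fun y => dif_pos h]
    exact Continuous.div (by fun_prop) (by fun_prop) h0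
  · rw [show bubbleAngle n a = fun y => (1 - ‖y‖ ^ 2) / (1 + ‖y‖ ^ 2) from
      funext fun y => dif_neg h]
    exact Continuous.div (by fun_prop) (by fun_prop) h0

lemma abs_bubbleAngle_le_one (n : ℕ) (a : Fin (n + 1)) (y : Euc n) : |bubbleAngle n a y| ≤ 1 := by
  have h0 : 0 < 1 + ‖y‖ ^ 2 := by positivity
  unfold bubbleAngle
  split_ifs with h
  · have h1 : |y ⟨a, h⟩| ≤ ‖y‖ := by simpa using PiLp.norm_apply_le y ⟨a, h⟩
    rw [abs_div, abs_of_pos h0, div_le_one h0, abs_mul, abs_two]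
    nlinarith [sq_nonneg (‖y‖ - 1)]
  · rw [abs_div, abs_of_pos h0, div_le_one h0, abs_le]
    constructor <;> nlinarith [sq_nonneg ‖y‖]

lemma exists_bubbleAngle_ne_zero (n : ℕ) (a : Fin (n + 1)) : ∃ y, bubbleAngle n a y ≠ 0 := by
  by_cases h : (a : ℕ) < n
  · refine ⟨EuclideanSpace.single ⟨a, h⟩ 1, ?_⟩
    simp [bubbleAngle, h]
  · exact ⟨0, by simp [bubbleAngle, h]⟩

lemma exists_linearIsometryEquiv_bubbleAngle_neg {n : ℕ} {a b : Fin (n + 1)} (hab : a ≠ b)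
    (h : (a : ℕ) < n) :
    ∃ R : Euc n ≃ₗᵢ[ℝ] Euc n, ∀ y, bubbleAngle n a (R y) = -bubbleAngle n a y ∧
      bubbleAngle n b (R y) = bubbleAngle n b y := by
  let e : Euc n := EuclideanSpace.single ⟨a, h⟩ 1
  have hR (y : Euc n) : (ℝ ∙ e)ᗮ.reflection y = y - (2 * y ⟨a, h⟩) • e := by
    rw [Submodule.reflection_orthogonal_apply, Submodule.reflection_singleton_apply]
    simp [e, EuclideanSpace.inner_single_left, two_smul, two_mul, add_smul]
  refine ⟨(ℝ ∙ e)ᗮ.reflection, fun y => ⟨?_, ?_⟩⟩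
  · simp only [bubbleAngle, dif_pos h, LinearIsometryEquiv.norm_map]
    rw [hR]
    simp [e]
    ring
  · simp only [bubbleAngle, LinearIsometryEquiv.norm_map]
    split_ifs with hb
    · have hne : (⟨b, hb⟩ : Fin n) ≠ ⟨a, h⟩ := by
        simpa [Fin.ext_iff, eq_comm] using hab
      rw [hR]
      simp [e, hne]
    · rfl

lemma integral_mul_bubbleAngle_eq_zero {n : ℕ} {a b : Fin (n + 1)} (hab : a ≠ b) (f : ℝ → ℝ) :
    ∫ y : Euc n, f ‖y‖ * (bubbleAngle n a y * bubbleAngle n b y) = 0 := by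
  wlog h : (a : ℕ) < n generalizing a b
  · have hb : (b : ℕ) < n := by
      have := a.2; have := b.2; have := Fin.val_ne_of_ne hab; omega
    simpa only [mul_comm (bubbleAngle n b _)] using this hab.symm hb
  obtain ⟨R, hR⟩ := exists_linearIsometryEquiv_bubbleAngle_neg hab h
  have key := R.measurePreserving.integral_comp R.toHomeomorph.measurableEmbedding
    (fun y : Euc n => f ‖y‖ * (bubbleAngle n a y * bubbleAngle n b y))
  simp only [hR, LinearIsometryEquiv.norm_map, neg_mul, mul_neg, integral_neg] at key
  linarith

lemma integral_comp_smul_sub {n : ℕ} (f : Euc n → ℝ) (z : Euc n) {l : ℝ} (hl : 0 < l) :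
    ∫ x, f (l • (x - z)) = (l ^ n)⁻¹ * ∫ y, f y := by
  rw [integral_sub_right_eq_self (fun x => f (l • x)) z, Measure.integral_comp_smul,
    finrank_euclideanSpace_fin, abs_of_pos (by positivity), smul_eq_mul]

lemma integrable_comp_smul_sub {n : ℕ} {f : Euc n → ℝ} (hf : Integrable f) (z : Euc n) {l : ℝ}
    (hl : 0 < l) : Integrable fun x => f (l • (x - z)) :=
  ((integrable_comp_smul_iff volume f hl.ne').2 hf).comp_sub_right z

lemma norm_smul_sub_sq {n : ℕ} (x z : Euc n) (l : ℝ) :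
    ‖l • (x - z)‖ ^ 2 = l ^ 2 * ‖x - z‖ ^ 2 := by
  rw [norm_smul, mul_pow, Real.norm_eq_abs, sq_abs]

lemma bubble_pos (n : ℕ) {cns : ℝ} (s : ℝ) (z : Euc n) {l : ℝ} (hc : 0 < cns) (hl : 0 < l)
    (x : Euc n) : 0 < bubble n cns s z l x := by
  unfold bubble; positivity

lemma Zb_eq (n : ℕ) (cns s : ℝ) (z : Euc n) {l : ℝ} (hl : 0 < l) (a : Fin (n + 1)) (x : Euc n) :
    Zb n cns s z l a x =
      ((n : ℝ) - 2 * s) / 2 * bubble n cns s z l x * bubbleAngle n a (l • (x - z)) := by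
  have h0 : 0 < 1 + l ^ 2 * ‖x - z‖ ^ 2 := by positivity
  have hB : 0 < l / (1 + l ^ 2 * ‖x - z‖ ^ 2) := by positivity
  unfold Zb bubbleAngle
  split_ifs with h
  · set e : Euc n := EuclideanSpace.single ⟨a, h⟩ 1 with he
    have hsq (t : ℝ) : ‖x - (z + t • e)‖ ^ 2 = ‖x - z‖ ^ 2 - 2 * t * (x - z) ⟨a, h⟩ + t ^ 2 := by
      rw [← sub_sub, @norm_sub_sq_real, inner_smul_right, norm_smul, mul_pow, he,
        EuclideanSpace.inner_single_right]
      simp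
      ring
    have hd : HasDerivAt (fun t : ℝ => bubble n cns s (z + t • e) l x)
        (cns * (((-(l * (l ^ 2 * (-2 * (x - z) ⟨a, h⟩)))) / (1 + l ^ 2 * ‖x - z‖ ^ 2) ^ 2) *
          (((n : ℝ) - 2 * s) / 2) *
          (l / (1 + l ^ 2 * ‖x - z‖ ^ 2)) ^ (((n : ℝ) - 2 * s) / 2 - 1))) 0 := by
      simp only [bubble, hsq]
      have h1 : HasDerivAt (fun t : ℝ => 1 + l ^ 2 *
          (‖x - z‖ ^ 2 - 2 * t * (x - z) ⟨a, h⟩ + t ^ 2))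
          (l ^ 2 * (-2 * (x - z) ⟨a, h⟩)) 0 := by
        have := (((((hasDerivAt_id (0 : ℝ)).const_mul 2).mul_const ((x - z) ⟨a, h⟩)).const_sub
          (‖x - z‖ ^ 2)).add (hasDerivAt_pow 2 (0 : ℝ))).const_mul (l ^ 2) |>.const_add 1
        convert! this using 1
        simp
      have h2 := (hasDerivAt_const (0 : ℝ) l).fun_div h1 (by simpa using h0.ne')
      have h3 := (h2.rpow_const (p := ((n : ℝ) - 2 * s) / 2)
        (Or.inl (by simpa using hB.ne'))).const_mul cns
      convert! h3 using 1
      simp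
    simp only [dZBubble]
    rw [hd.deriv, norm_smul_sub_sq, Real.rpow_sub_one hB.ne', bubble]
    simp only [PiLp.smul_apply, smul_eq_mul]
    field_simp
  · have hd : HasDerivAt (fun t : ℝ => bubble n cns s z t x)
        (cns * ((1 * (1 + l ^ 2 * ‖x - z‖ ^ 2) - l * (2 * l * ‖x - z‖ ^ 2)) /
          (1 + l ^ 2 * ‖x - z‖ ^ 2) ^ 2 * (((n : ℝ) - 2 * s) / 2) *
          (l / (1 + l ^ 2 * ‖x - z‖ ^ 2)) ^ (((n : ℝ) - 2 * s) / 2 - 1))) l := by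
      simp only [bubble]
      have h1 : HasDerivAt (fun t : ℝ => 1 + t ^ 2 * ‖x - z‖ ^ 2) (2 * l * ‖x - z‖ ^ 2) l := by
        simpa using ((hasDerivAt_pow 2 l).mul_const (‖x - z‖ ^ 2)).const_add 1
      exact (((hasDerivAt_id l).fun_div h1 h0.ne').rpow_const (Or.inl hB.ne')).const_mul cns
    simp only [dLamBubble]
    rw [hd.deriv, norm_smul_sub_sq, Real.rpow_sub_one hB.ne', bubble]
    field_simp
    ring

lemma half_sub_mul_pexp {n : ℕ} {s : ℝ} (hn : 2 * s < (n : ℝ)) :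
    ((n : ℝ) - 2 * s) / 2 * pexp n s = ((n : ℝ) + 2 * s) / 2 := by
  have : (n : ℝ) - 2 * s ≠ 0 := by linarith
  unfold pexp
  field_simp

lemma bubble_rpow_pexp {n : ℕ} {s cns l : ℝ} (hn : 2 * s < (n : ℝ)) (hc : 0 < cns) (hl : 0 < l)
    (z x : Euc n) :
    bubble n cns s z l x ^ pexp n s = cns ^ pexp n s *
      (l / (1 + ‖l • (x - z)‖ ^ 2)) ^ (((n : ℝ) + 2 * s) / 2) := by
  rw [bubble, Real.mul_rpow hc.le (by positivity), ← Real.rpow_mul (by positivity),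
    half_sub_mul_pexp hn, norm_smul_sub_sq]

/-- Products of a bubble power with two rescaled derivatives, in terms of bubbles. -/
lemma bubble_rpow_mul_Zb_mul_Zb {n : ℕ} {s cns li lj : ℝ} (hc : 0 < cns)
    (hi : 0 < li) (hj : 0 < lj) (zi zj x : Euc n) (a b : Fin (n + 1)) :
    bubble n cns s zi li x ^ (pexp n s - 1) * Zb n cns s zi li a x * Zb n cns s zj lj b x =
      (((n : ℝ) - 2 * s) / 2) ^ 2 * (bubble n cns s zi li x ^ pexp n s * bubble n cns s zj lj x) *
        (bubbleAngle n a (li • (x - zi)) * bubbleAngle n b (lj • (x - zj))) := by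
  have := bubble_pos n s zi hc hi x
  rw [Zb_eq n cns s zi hi, Zb_eq n cns s zj hj, Real.rpow_sub_one this.ne']
  field_simp

lemma integral_bubble_Zb_Zb {n : ℕ} {s cns l : ℝ} (hn : 2 * s < (n : ℝ)) (hc : 0 < cns)
    (hl : 0 < l) (z : Euc n) (a b : Fin (n + 1)) :
    ∫ x, bubble n cns s z l x ^ (pexp n s - 1) * Zb n cns s z l a x * Zb n cns s z l b x =
      (((n : ℝ) - 2 * s) / 2) ^ 2 * (cns ^ pexp n s * cns) *
        ∫ y : Euc n, (1 + ‖y‖ ^ 2) ^ (-(n : ℝ)) * (bubbleAngle n a y * bubbleAngle n b y) := by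
  set f := fun y : Euc n => l ^ n * ((((n : ℝ) - 2 * s) / 2) ^ 2 *
    (cns ^ pexp n s * cns) * ((1 + ‖y‖ ^ 2) ^ (-(n : ℝ)) *
      (bubbleAngle n a y * bubbleAngle n b y))) with hf
  have key (x : Euc n) : bubble n cns s z l x ^ (pexp n s - 1) * Zb n cns s z l a x *
      Zb n cns s z l b x = f (l • (x - z)) := by
    rw [hf]
    beta_reduce
    rw [bubble_rpow_mul_Zb_mul_Zb hc hl hl, bubble_rpow_pexp hn hc hl, bubble,
      ← norm_smul_sub_sq]
    have hB : 0 < l / (1 + ‖l • (x - z)‖ ^ 2) := by positivity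
    have : (l / (1 + ‖l • (x - z)‖ ^ 2)) ^ (((n : ℝ) + 2 * s) / 2) *
        (l / (1 + ‖l • (x - z)‖ ^ 2)) ^ (((n : ℝ) - 2 * s) / 2) =
        l ^ n * (1 + ‖l • (x - z)‖ ^ 2) ^ (-(n : ℝ)) := by
      rw [← Real.rpow_add hB, show ((n : ℝ) + 2 * s) / 2 + ((n : ℝ) - 2 * s) / 2 = n by ring,
        Real.rpow_neg (by positivity), Real.rpow_natCast, Real.rpow_natCast, div_pow]
      rfl
    linear_combination (((n : ℝ) - 2 * s) / 2) ^ 2 * (cns ^ pexp n s * cns) *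
      (bubbleAngle n a (l • (x - z)) * bubbleAngle n b (l • (x - z))) * this
  rw [integral_congr_ae (Filter.Eventually.of_forall key), integral_comp_smul_sub f z hl, hf, integral_const_mul, integral_const_mul,
    inv_mul_cancel_left₀ (by positivity)]

lemma integrable_one_add_norm_sq_rpow_neg {n : ℕ} {r : ℝ} (hr : (n : ℝ) < 2 * r) :
    Integrable fun y : Euc n => (1 + ‖y‖ ^ 2) ^ (-r) := by
  have := integrable_rpow_neg_one_add_norm_sq (E := Euc n) (μ := volume) (r := 2 * r)
    (by simpa using hr)
  simpa [neg_div] using this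

lemma integral_mul_bubbleAngle_self_pos {n : ℕ} (hn : 0 < n) (a : Fin (n + 1)) :
    0 < ∫ y : Euc n, (1 + ‖y‖ ^ 2) ^ (-(n : ℝ)) * (bubbleAngle n a y * bubbleAngle n a y) := by
  obtain ⟨y, hy⟩ := exists_bubbleAngle_ne_zero n a
  have hcont := continuous_bubbleAngle n a
  have h0 (y : Euc n) : 1 + ‖y‖ ^ 2 ≠ 0 := by positivity
  refine integral_pos_of_integrable_nonneg_nonzero (x := y) ?_ ?_ ?_ ?_
  · refine Continuous.mul (Continuous.rpow_const (by fun_prop) fun y => Or.inl (h0 y)) ?_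
    fun_prop
  · refine (integrable_one_add_norm_sq_rpow_neg ?_).mul_bdd (c := 1) ?_ ?_
    · have : (0 : ℝ) < n := by exact_mod_cast hn
      linarith
    · exact (hcont.mul hcont).aestronglyMeasurable
    · refine Filter.Eventually.of_forall fun y => ?_
      rw [norm_mul, Real.norm_eq_abs]
      exact mul_le_one₀ (abs_bubbleAngle_le_one n a y) (abs_nonneg _) (abs_bubbleAngle_le_one n a y)
  · exact fun y => mul_nonneg (by positivity) (mul_self_nonneg _)
  · have : 0 < 1 + ‖y‖ ^ 2 := by positivity
    positivity

/-- An integrable radial profile dominating the interaction of two bubbles near the second one. -/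
def bubbleProfile (α A : ℝ) (b : ℝ) : ℝ :=
  (Set.Iio 1).indicator (fun b => (b ^ 2) ^ (-α)) b + (1 + b ^ 2) ^ (-A)

lemma bubbleProfile_nonneg (α A b : ℝ) : 0 ≤ bubbleProfile α A b :=
  add_nonneg (Set.indicator_nonneg (fun _ _ => by positivity) _) (by positivity)

lemma integrable_bubbleProfile {n : ℕ} {α A : ℝ} (hn : 0 < n) (hα : 2 * α < n)
    (hA : (n : ℝ) < 2 * A) : Integrable fun y : Euc n => bubbleProfile α A ‖y‖ := by
  refine Integrable.add ?_ (integrable_one_add_norm_sq_rpow_neg hA)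
  have : Nonempty (Fin n) := ⟨⟨0, hn⟩⟩
  rw [integrable_fun_norm_addHaar volume
    (f := (Set.Iio 1).indicator (fun b : ℝ => (b ^ 2) ^ (-α))), finrank_euclideanSpace_fin]
  have h1 : IntegrableOn (fun t : ℝ => t ^ ((n : ℝ) - 1 - 2 * α)) (Set.Ioo 0 1) :=
    (intervalIntegral.integrableOn_Ioo_rpow_iff one_pos).2 (by linarith)
  have h2 := (integrable_indicator_iff measurableSet_Ioo).2 h1
  refine h2.integrableOn.congr_fun (fun t ht => ?_) measurableSet_Ioi
  have ht : 0 < t := ht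
  by_cases h : t < 1
  · simp only [Set.indicator_of_mem (show t ∈ Set.Ioo (0 : ℝ) 1 from ⟨ht, h⟩),
      Set.indicator_of_mem (show t ∈ Set.Iio (1 : ℝ) from h), smul_eq_mul]
    rw [← Real.rpow_natCast t 2, ← Real.rpow_mul ht.le, ← Real.rpow_natCast,
      ← Real.rpow_add ht, Nat.cast_sub hn]
    congr 1
    push_cast
    ring
  · simp [h]

lemma interaction_pointwise {α A a b c μ : ℝ} (hα : 0 ≤ α) (hαA : α ≤ A) (ha : 0 ≤ a) (hb : 0 < b)
    (hc : 0 ≤ c) (h : c ≤ a + b) :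
    (1 + a ^ 2) ^ (-A) * (1 + μ ^ 2 * b ^ 2) ^ (-α) ≤
      16 ^ A * (1 + μ ^ 2 * (1 + c ^ 2)) ^ (-α) *
        ((1 + a ^ 2) ^ (-A) + bubbleProfile α A b) := by
  have hA : 0 ≤ A := hα.trans hαA
  set W := 1 + c ^ 2 with hW
  have hW1 : 1 ≤ W := by nlinarith
  have hW0 : 0 < W := by linarith
  set P := (1 + μ ^ 2 * W) ^ (-α) with hP
  have hP0 : 0 < P := by positivity
  have hg := bubbleProfile_nonneg α A b
  have ha' : 0 ≤ (1 + a ^ 2) ^ (-A) := by positivity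
  rcases le_or_gt W (16 * b ^ 2) with hcase | hcase
  · have h1 : (1 + μ ^ 2 * b ^ 2) ^ (-α) ≤ 16 ^ A * P := by
      calc (1 + μ ^ 2 * b ^ 2) ^ (-α) ≤ ((1 + μ ^ 2 * W) / 16) ^ (-α) := by
            refine Real.rpow_le_rpow_of_nonpos (by positivity) ?_ (by linarith)
            nlinarith [mul_le_mul_of_nonneg_left hcase (sq_nonneg μ)]
        _ = 16 ^ α * P := by
            rw [Real.div_rpow (by positivity) (by norm_num), Real.rpow_neg (by norm_num : (0:ℝ) ≤ 16),
              div_inv_eq_mul, mul_comm]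
        _ ≤ 16 ^ A * P := by
            gcongr
            norm_num
    calc _ ≤ (1 + a ^ 2) ^ (-A) * (16 ^ A * P) := by gcongr
      _ = 16 ^ A * P * ((1 + a ^ 2) ^ (-A)) := by ring
      _ ≤ _ := by gcongr; linarith
  · have hb2 : 0 < b ^ 2 := by positivity
    have hWa : W ≤ 4 * (1 + a ^ 2) := by nlinarith [sq_nonneg (a - b)]
    have h1 : (1 + a ^ 2) ^ (-A) ≤ 4 ^ A * W ^ (-A) := by
      calc (1 + a ^ 2) ^ (-A) ≤ (W / 4) ^ (-A) :=
            Real.rpow_le_rpow_of_nonpos (by positivity) (by linarith) (by linarith)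
        _ = _ := by
            rw [Real.div_rpow (by positivity) (by norm_num), Real.rpow_neg (by norm_num : (0:ℝ) ≤ 4),
              div_inv_eq_mul, mul_comm]
    have h2 : (1 + μ ^ 2 * b ^ 2) ^ (-α) ≤ (b ^ 2) ^ (-α) * W ^ α * P := by
      calc (1 + μ ^ 2 * b ^ 2) ^ (-α) ≤ (b ^ 2 / W * (1 + μ ^ 2 * W)) ^ (-α) := by
            refine Real.rpow_le_rpow_of_nonpos (by positivity) ?_ (by linarith)
            have : b ^ 2 / W ≤ 1 := (div_le_one hW0).2 (by linarith)
            have e : b ^ 2 / W * (1 + μ ^ 2 * W) = b ^ 2 / W + μ ^ 2 * b ^ 2 := by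
              field_simp
            linarith
        _ = _ := by
            rw [Real.mul_rpow (by positivity) (by positivity),
              Real.div_rpow (by positivity) (by positivity), Real.rpow_neg hW0.le,
              div_inv_eq_mul]
    have h3 : W ^ (α - A) * (b ^ 2) ^ (-α) ≤ 2 ^ A * bubbleProfile α A b := by
      have h2A : (1 : ℝ) ≤ 2 ^ A := Real.one_le_rpow (by norm_num) hA
      rcases lt_or_ge b 1 with hb1 | hb1
      · calc W ^ (α - A) * (b ^ 2) ^ (-α) ≤ 1 * (b ^ 2) ^ (-α) := by
              gcongr
              exact Real.rpow_le_one_of_one_le_of_nonpos hW1 (by linarith)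
          _ ≤ 1 * bubbleProfile α A b := by
              gcongr
              rw [bubbleProfile, Set.indicator_of_mem (show b ∈ Set.Iio (1 : ℝ) from hb1)]
              exact le_add_of_nonneg_right (by positivity)
          _ ≤ _ := by gcongr
      · calc W ^ (α - A) * (b ^ 2) ^ (-α) ≤ (b ^ 2) ^ (α - A) * (b ^ 2) ^ (-α) := by
              gcongr ?_ * _
              exact Real.rpow_le_rpow_of_nonpos hb2 (by linarith) (by linarith)
          _ = (b ^ 2) ^ (-A) := by rw [← Real.rpow_add hb2]; congr 1; ring
          _ ≤ ((1 + b ^ 2) / 2) ^ (-A) :=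
              Real.rpow_le_rpow_of_nonpos (by positivity) (by nlinarith) (by linarith)
          _ = 2 ^ A * (1 + b ^ 2) ^ (-A) := by
              rw [Real.div_rpow (by positivity) (by norm_num),
                Real.rpow_neg (by norm_num : (0:ℝ) ≤ 2), div_inv_eq_mul, mul_comm]
          _ ≤ _ := by
              gcongr
              exact le_add_of_nonneg_left (Set.indicator_nonneg (fun _ _ => by positivity) _)
    calc _ ≤ 4 ^ A * W ^ (-A) * ((b ^ 2) ^ (-α) * W ^ α * P) := by gcongr
      _ = 4 ^ A * P * (W ^ (α - A) * (b ^ 2) ^ (-α)) := by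
          rw [sub_eq_add_neg, Real.rpow_add hW0]; ring
      _ ≤ 4 ^ A * P * (2 ^ A * bubbleProfile α A b) := by gcongr
      _ = 8 ^ A * P * bubbleProfile α A b := by
          rw [show (8 : ℝ) = 4 * 2 by norm_num, Real.mul_rpow (by norm_num) (by norm_num)]; ring
      _ ≤ 16 ^ A * P * ((1 + a ^ 2) ^ (-A) + bubbleProfile α A b) := by
          gcongr
          · norm_num
          · linarith

/-- Pointwise bound of the interaction of two bubbles by an integrable profile. -/
lemma bubble_rpow_mul_bubble_le {n : ℕ} {s cns li lj : ℝ} (hs0 : 0 < s) (hn : 2 * s < (n : ℝ))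
    (hc : 0 < cns) (hi : 0 < li) (hj : 0 < lj) {zi zj x : Euc n} (hx : x ≠ zj) :
    bubble n cns s zi li x ^ pexp n s * bubble n cns s zj lj x ≤
      cns ^ pexp n s * cns * (16 ^ (((n : ℝ) + 2 * s) / 2) *
        (li ^ n * (li / lj + lj / li + li * lj * ‖zi - zj‖ ^ 2) ^ (-(((n : ℝ) - 2 * s) / 2))) *
        ((1 + ‖li • (x - zi)‖ ^ 2) ^ (-(((n : ℝ) + 2 * s) / 2)) +
          bubbleProfile (((n : ℝ) - 2 * s) / 2) (((n : ℝ) + 2 * s) / 2)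
            ‖li • (x - zi) - li • (zj - zi)‖)) := by
  set α := ((n : ℝ) - 2 * s) / 2 with hα
  set A := ((n : ℝ) + 2 * s) / 2 with hA
  set D := li / lj + lj / li + li * lj * ‖zi - zj‖ ^ 2 with hD
  have hD0 : 0 < D := by positivity
  have hsub : li • (x - zi) - li • (zj - zi) = li • (x - zj) := by
    rw [← smul_sub, sub_sub_sub_cancel_right]
  have hu : 0 < ‖li • (x - zj)‖ := by
    rw [norm_pos_iff]
    exact smul_ne_zero hi.ne' (sub_ne_zero.2 hx)
  have htri : ‖li • (zj - zi)‖ ≤ ‖li • (x - zi)‖ + ‖li • (x - zj)‖ := by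
    rw [← hsub]
    simpa [sub_sub_cancel] using norm_sub_le (li • (x - zi)) (li • (x - zi) - li • (zj - zi))
  have key := interaction_pointwise (α := α) (A := A) (μ := lj / li) (by linarith) (by linarith)
    (norm_nonneg (li • (x - zi))) hu (norm_nonneg (li • (zj - zi))) htri
  have h1 : (lj / li) ^ 2 * ‖li • (x - zj)‖ ^ 2 = lj ^ 2 * ‖x - zj‖ ^ 2 := by
    rw [norm_smul_sub_sq]; field_simp
  have h2 : 1 + (lj / li) ^ 2 * (1 + ‖li • (zj - zi)‖ ^ 2) = lj / li * D := by
    rw [norm_smul_sub_sq, norm_sub_rev zj zi, hD]; field_simp; ring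
  have h3 : lj ^ α * (lj / li * D) ^ (-α) = li ^ α * D ^ (-α) := by
    rw [Real.mul_rpow (by positivity) hD0.le, Real.div_rpow hj.le hi.le, Real.rpow_neg hj.le,
      Real.rpow_neg hi.le]
    have := Real.rpow_pos_of_pos hj α
    have := Real.rpow_pos_of_pos hi α
    field_simp
  have h4 : li ^ A * li ^ α = li ^ n := by
    rw [← Real.rpow_add hi, ← Real.rpow_natCast]; congr 1; rw [hA, hα]; ring
  rw [h1, h2] at key
  rw [hsub, bubble_rpow_pexp hn hc hi, bubble, ← hα, ← hA,
    Real.div_rpow hi.le (by positivity), Real.div_rpow hj.le (by positivity),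
    div_eq_mul_inv (li ^ A), div_eq_mul_inv (lj ^ α), ← Real.rpow_neg (by positivity),
    ← Real.rpow_neg (by positivity)]
  set g := bubbleProfile α A ‖li • (x - zj)‖
  set P := (1 + ‖li • (x - zi)‖ ^ 2) ^ (-A)
  set Q := (1 + lj ^ 2 * ‖x - zj‖ ^ 2) ^ (-α)
  calc _ = cns ^ pexp n s * cns * (li ^ A * lj ^ α) * (P * Q) := by ring
    _ ≤ cns ^ pexp n s * cns * (li ^ A * lj ^ α) *
        (16 ^ A * (lj / li * D) ^ (-α) * (P + g)) := by gcongr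
    _ = cns ^ pexp n s * cns * li ^ A * 16 ^ A * (P + g) *
        (lj ^ α * (lj / li * D) ^ (-α)) := by ring
    _ = _ := by rw [h3, ← h4]; ring

/-- integrals of the rescaled derivatives `Z_i^a`.
There are `γ^a = γ^a(n,s) > 0` with `∫ U_i^{p-1} Z_i^a Z_i^b = 0` for `a ≠ b`,
`∫ U_i^{p-1} (Z_i^a)² = γ^a`, and for distinct bubbles
`|∫ U_i^{p-1} Z_i^a Z_j^b| ≤ C(n,s) q_{ij}`. -/
theorem stmt_19 (n : ℕ) (s cns : ℝ) (hs0 : 0 < s) (hs1 : s < 1) (hn : 2 * s < (n : ℝ))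
    (hc : 0 < cns) :
    ∃ γ : Fin (n + 1) → ℝ, (∀ a, 0 < γ a) ∧ ∃ C : ℝ, 0 < C ∧
      ∀ (zi zj : Euc n) (li lj : ℝ), 0 < li → 0 < lj →
        (∀ a b : Fin (n + 1), a ≠ b →
          (∫ x, bubble n cns s zi li x ^ (pexp n s - 1) *
            Zb n cns s zi li a x * Zb n cns s zi li b x) = 0) ∧
        (∀ a : Fin (n + 1),
          (∫ x, bubble n cns s zi li x ^ (pexp n s - 1) *
            Zb n cns s zi li a x * Zb n cns s zi li a x) = γ a) ∧
        ((zi ≠ zj ∨ li ≠ lj) → ∀ a b : Fin (n + 1),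
          |∫ x, bubble n cns s zi li x ^ (pexp n s - 1) *
            Zb n cns s zi li a x * Zb n cns s zj lj b x| ≤
          C * (li / lj + lj / li + li * lj * ‖zi - zj‖ ^ 2) ^
            (-(((n : ℝ) - 2 * s) / 2))) := by
  have hn0 : 0 < n := by
    have : (0 : ℝ) < n := by linarith
    exact_mod_cast this
  have : Nonempty (Fin n) := ⟨⟨0, hn0⟩⟩
  set α := ((n : ℝ) - 2 * s) / 2 with hα
  have hα0 : 0 < α := by linarith
  set A := ((n : ℝ) + 2 * s) / 2 with hA
  set K := α ^ 2 * (cns ^ pexp n s * cns) with hK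
  have hK0 : 0 < K := by positivity
  set I := (∫ y : Euc n, (1 + ‖y‖ ^ 2) ^ (-A)) + ∫ y : Euc n, bubbleProfile α A ‖y‖ with hI
  have hI0 : 0 ≤ I := add_nonneg (integral_nonneg fun y => by positivity)
    (integral_nonneg fun y => bubbleProfile_nonneg α A ‖y‖)
  refine ⟨fun a => K *
    ∫ y : Euc n, (1 + ‖y‖ ^ 2) ^ (-(n : ℝ)) * (bubbleAngle n a y * bubbleAngle n a y),
    fun a => mul_pos hK0 (integral_mul_bubbleAngle_self_pos hn0 a),
    K * 16 ^ A * I + 1, by positivity, fun zi zj li lj hi hj => ⟨fun a b hab => ?_, fun a => ?_,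
    fun _ a b => ?_⟩⟩
  · rw [integral_bubble_Zb_Zb hn hc hi,
      integral_mul_bubbleAngle_eq_zero hab (fun t => (1 + t ^ 2) ^ (-(n : ℝ))), mul_zero]
  · exact integral_bubble_Zb_Zb hn hc hi zi a a
  · set D := li / lj + lj / li + li * lj * ‖zi - zj‖ ^ 2
    set w := li • (zj - zi)
    have hint1 : Integrable fun y : Euc n => (1 + ‖y‖ ^ 2) ^ (-A) :=
      integrable_one_add_norm_sq_rpow_neg (by linarith)
    have hint2 : Integrable fun y : Euc n => bubbleProfile α A ‖y‖ :=
      integrable_bubbleProfile hn0 (by linarith) (by linarith)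
    have hint : Integrable fun y : Euc n =>
        (1 + ‖y‖ ^ 2) ^ (-A) + bubbleProfile α A ‖y - w‖ := hint1.add (hint2.comp_sub_right w)
    set G := fun y : Euc n => (1 + ‖y‖ ^ 2) ^ (-A) + bubbleProfile α A ‖y - w‖ with hG
    have hGI : ∫ y, G y = I := by
      rw [hG, integral_add hint1 (hint2.comp_sub_right w),
        integral_sub_right_eq_self (fun y : Euc n => bubbleProfile α A ‖y‖) w]
    have hD : 0 ≤ D ^ (-α) := by positivity
    have hbound : ‖∫ x, bubble n cns s zi li x ^ (pexp n s - 1) *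
        Zb n cns s zi li a x * Zb n cns s zj lj b x‖ ≤
        ∫ x, K * (16 ^ A * (li ^ n * D ^ (-α)) * G (li • (x - zi))) := by
      refine norm_integral_le_of_norm_le
        (((integrable_comp_smul_sub hint zi hi).const_mul _).const_mul _) ?_
      filter_upwards [compl_mem_ae_iff.2 (measure_singleton zj)] with x hx
      have hU := (bubble_pos n s zi hc hi x).le
      have hV := (bubble_pos n s zj hc hj x).le
      rw [bubble_rpow_mul_Zb_mul_Zb hc hi hj, norm_mul, Real.norm_of_nonneg (by positivity),
        norm_mul, Real.norm_eq_abs, Real.norm_eq_abs]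
      refine (mul_le_of_le_one_right (by positivity) (mul_le_one₀
        (abs_bubbleAngle_le_one n a _) (abs_nonneg _) (abs_bubbleAngle_le_one n b _))).trans ?_
      have := bubble_rpow_mul_bubble_le hs0 hn hc hi hj (x := x) (zi := zi) (zj := zj) hx
      refine (mul_le_mul_of_nonneg_left this (sq_nonneg α)).trans_eq ?_
      rw [hK, hG]
      ring
    refine hbound.trans ?_
    rw [integral_const_mul, integral_const_mul, integral_comp_smul_sub _ _ hi, hGI]
    calc _ = K * 16 ^ A * I * D ^ (-α) := by field_simp
      _ ≤ _ := by gcongr; linarith
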